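/- Let n ≥ 1, let q be a unit of ℤ/nℤ, and let a ∈ ℤ/nℤ with a ≠ 0, such that q^t·a ≠ −a for every integer t (the orbit of a under multiplication by q is asymmetric). Let m be the smallest positive integer with q^m·a = a. Let ŝ and Q̂ denote the permutations of ℤ/nℤ × ℤ/nℤ given by (x,y) ↦ (x+1, y+1) and (x,y) ↦ (qx, qy), and let Γ be the subgroup they generate. Then the stabilizer in Γ of the point (0,a) and the stabilizer in Γ of the two-element set {(0,a), (a,0)} both equal the cyclic subgroup generated by Q̂^m. -/

import Mathlib

/-- The set `X` of pairs `(x, y)` in `ℤ/nℤ × ℤ/nℤ` with `x ≠ y`. -/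
abbrev rootSet (n : ℕ) := {p : ZMod n × ZMod n // p.1 ≠ p.2}

/-- The permutation of `rootSet n` induced by `(x, y) ↦ (x + c, y + c)`. -/
def trX (n : ℕ) (c : ZMod n) : Equiv.Perm (rootSet n) :=
  Equiv.Perm.subtypePerm ((Equiv.addRight c).prodCongr (Equiv.addRight c)) (by intro p; simp)

/-- The permutation `ŝ : (x, y) ↦ (x + 1, y + 1)` of `rootSet n`. -/
def sHat (n : ℕ) : Equiv.Perm (rootSet n) := trX n 1

/-- The permutation `Q̂ : (x, y) ↦ (q x, q y)` of `rootSet n`. -/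
def qHat (n : ℕ) (q : (ZMod n)ˣ) : Equiv.Perm (rootSet n) :=
  Equiv.Perm.subtypePerm ((MulAction.toPerm q).prodCongr (MulAction.toPerm q)) (by
    intro p
    simp only [Equiv.prodCongr_apply, Prod.map, MulAction.toPerm_apply, ne_eq,
      smul_left_cancel_iff])

/-- The subgroup `Γ` of permutations of `rootSet n` generated by `ŝ` and `Q̂`. -/
def ΓHat (n : ℕ) (q : (ZMod n)ˣ) : Subgroup (Equiv.Perm (rootSet n)) :=
  Subgroup.closure {sHat n, qHat n q}

/-- The point `η(z) = (0, z)` of `rootSet n`, for `z ≠ 0`. -/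
def ηpt (n : ℕ) (z : ZMod n) (hz : z ≠ 0) : rootSet n := ⟨(0, z), fun h => hz h.symm⟩


/-- The point `(a, 0)` of `rootSet n`, the negative of the root `η(a) = (0, a)`. -/
def ηptNeg (n : ℕ) (a : ZMod n) (ha : a ≠ 0) : rootSet n := ⟨(a, 0), fun h => ha h⟩

theorem aux_trX_apply (n : ℕ) (c : ZMod n) (p : rootSet n) :
    (trX n c p).1 = (p.1.1 + c, p.1.2 + c) := rfl

theorem aux_qHat_apply (n : ℕ) (u : (ZMod n)ˣ) (p : rootSet n) :
    (qHat n u p).1 = ((u : ZMod n) * p.1.1, (u : ZMod n) * p.1.2) := rfl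

theorem aux_qHat_mul (n : ℕ) (u v : (ZMod n)ˣ) : qHat n (u * v) = qHat n u * qHat n v := by
  ext p <;> simp [aux_qHat_apply, mul_assoc]

/-- `qHat` as a homomorphism. -/
def auxHom (n : ℕ) : (ZMod n)ˣ →* Equiv.Perm (rootSet n) :=
  MonoidHom.mk' (qHat n) (aux_qHat_mul n)

theorem aux_qHat_zpow (n : ℕ) (u : (ZMod n)ˣ) (t : ℤ) : qHat n u ^ t = qHat n (u ^ t) :=
  (map_zpow (auxHom n) u t).symm

theorem aux_trX_mul (n : ℕ) (c d : ZMod n) : trX n c * trX n d = trX n (d + c) := by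
  ext p <;> simp [aux_trX_apply, add_assoc]

theorem aux_trX_zero (n : ℕ) : trX n 0 = 1 := by
  ext p <;> simp [aux_trX_apply]

theorem aux_comm (n : ℕ) (u : (ZMod n)ˣ) (d : ZMod n) :
    qHat n u * trX n d = trX n (u * d) * qHat n u := by
  ext p <;> simp [aux_trX_apply, aux_qHat_apply, mul_add]

theorem aux_form (n : ℕ) (q : (ZMod n)ˣ) (γ : Equiv.Perm (rootSet n)) (h : γ ∈ ΓHat n q) :
    ∃ (c : ZMod n) (t : ℤ), γ = trX n c * qHat n (q ^ t) := by
  unfold ΓHat at h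
  induction h using Subgroup.closure_induction with
  | mem x hx =>
    rcases hx with rfl | rfl
    · refine ⟨1, 0, ?_⟩
      rw [← aux_qHat_zpow]; simp [sHat]
    · exact ⟨0, 1, by simp [aux_trX_zero]⟩
  | one => exact ⟨0, 0, by rw [← aux_qHat_zpow]; simp [aux_trX_zero]⟩
  | mul x y _ _ hx hy =>
    obtain ⟨c, t, rfl⟩ := hx
    obtain ⟨d, s, rfl⟩ := hy
    refine ⟨((q ^ t : (ZMod n)ˣ) : ZMod n) * d + c, t + s, ?_⟩
    rw [zpow_add, aux_qHat_mul, ← aux_trX_mul]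
    simp only [mul_assoc]
    rw [← mul_assoc (qHat n (q ^ t)) (trX n d), aux_comm]
    simp only [mul_assoc]
  | inv x _ hx =>
    obtain ⟨c, t, rfl⟩ := hx
    refine ⟨((q ^ (-t) : (ZMod n)ˣ) : ZMod n) * (-c), -t, ?_⟩
    rw [← aux_comm, inv_eq_iff_mul_eq_one]
    rw [mul_assoc, ← mul_assoc (qHat n (q ^ t)), ← aux_qHat_mul, ← zpow_add, add_neg_cancel,
      ← aux_qHat_zpow, zpow_zero, one_mul, aux_trX_mul, neg_add_cancel, aux_trX_zero]

theorem aux_dvd (n : ℕ) (q : (ZMod n)ˣ) (a : ZMod n) (m : ℕ) (hm : 0 < m)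
    (hmin : ∀ t : ℕ, 0 < t → t < m → (q : ZMod n) ^ t * a ≠ a)
    (hqm : (q : ZMod n) ^ m * a = a) (t : ℤ)
    (ht : ((q ^ t : (ZMod n)ˣ) : ZMod n) * a = a) : ∃ k : ℤ, t = m * k := by
  have h1 : q ^ m ∈ MulAction.stabilizer (ZMod n)ˣ a := by
    rw [MulAction.mem_stabilizer_iff, Units.smul_def]; simpa using hqm
  have h2 : q ^ t ∈ MulAction.stabilizer (ZMod n)ˣ a := by
    rw [MulAction.mem_stabilizer_iff, Units.smul_def]; simpa using ht
  have h3 : q ^ (t % m) ∈ MulAction.stabilizer (ZMod n)ˣ a := by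
    have : q ^ (t % m) = q ^ t * ((q ^ m) ^ (t / m))⁻¹ := by
      rw [← zpow_natCast, ← zpow_mul, ← zpow_neg, ← zpow_add, Int.emod_def, sub_eq_add_neg]
    rw [this]
    exact mul_mem h2 (inv_mem (zpow_mem h1 _))
  have hlt := Int.emod_lt_of_pos t (b := (m : ℤ)) (by exact_mod_cast hm)
  have hnn := Int.emod_nonneg t (b := (m : ℤ)) (by omega)
  obtain ⟨r, hr⟩ := Int.eq_ofNat_of_zero_le hnn
  rw [hr, zpow_natCast, MulAction.mem_stabilizer_iff, Units.smul_def] at h3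
  rcases Nat.eq_zero_or_pos r with h0 | h0
  · exact Int.dvd_of_emod_eq_zero (by rw [hr, h0]; rfl)
  · exact absurd (by simpa using h3) (hmin r h0 (by omega))

/-- Let `a ∈ ℤ/nℤ` be nonzero such that `qᵗ a ≠ -a` for every integer `t` (an asymmetric
orbit), and let `m` be the smallest positive integer with `qᵐ a = a`.  Then the stabilizer
in `Γ = ⟨ŝ, Q̂⟩` of the point `(0, a)` and the stabilizer in `Γ` of the pair
`{(0, a), (a, 0)}` both equal the cyclic subgroup generated by `Q̂^m`. -/
theorem epipelagic_stmt12 (n : ℕ) [NeZero n] (q : (ZMod n)ˣ) (a : ZMod n)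
    (ha : a ≠ 0)
    (hasym : ∀ t : ℤ, ((q ^ t : (ZMod n)ˣ) : ZMod n) * a ≠ -a)
    (m : ℕ) (hm : 0 < m)
    (hmin : ∀ t : ℕ, 0 < t → t < m → (q : ZMod n) ^ t * a ≠ a)
    (hqm : (q : ZMod n) ^ m * a = a) :
    {γ : Equiv.Perm (rootSet n) | γ ∈ ΓHat n q ∧ γ (ηpt n a ha) = ηpt n a ha} =
      ↑(Subgroup.zpowers ((qHat n q) ^ m)) ∧
    {γ : Equiv.Perm (rootSet n) | γ ∈ ΓHat n q ∧
        ⇑γ '' {ηpt n a ha, ηptNeg n a ha} = {ηpt n a ha, ηptNeg n a ha}} =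
      ↑(Subgroup.zpowers ((qHat n q) ^ m)) := by
  have key : ∀ γ : Equiv.Perm (rootSet n), γ ∈ ΓHat n q →
      γ (ηpt n a ha) = ηpt n a ha → γ ∈ Subgroup.zpowers ((qHat n q) ^ m) := by
    intro γ hγ hfix
    obtain ⟨c, t, rfl⟩ := aux_form n q γ hγ
    have h := congrArg Subtype.val hfix
    simp only [Equiv.Perm.mul_apply, aux_trX_apply, aux_qHat_apply, ηpt, Prod.mk.injEq,
      mul_zero, zero_add] at h
    obtain ⟨rfl, h2⟩ := h
    rw [add_zero] at h2
    obtain ⟨k, rfl⟩ := aux_dvd n q a m hm hmin hqm t h2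
    refine Subgroup.mem_zpowers_iff.2 ⟨k, ?_⟩
    rw [aux_trX_zero, one_mul, ← aux_qHat_zpow, zpow_mul, zpow_natCast]
  have hpow : qHat n q ^ m = qHat n (q ^ m) := by
    simpa using aux_qHat_zpow n q m
  have hmem : ∀ γ ∈ Subgroup.zpowers ((qHat n q) ^ m), γ ∈ ΓHat n q := by
    intro γ hγ
    exact (Subgroup.zpowers_le.2 (pow_mem (Subgroup.subset_closure (by simp)) m)) hγ
  have hfix1 : ∀ γ ∈ Subgroup.zpowers ((qHat n q) ^ m), γ (ηpt n a ha) = ηpt n a ha := by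
    intro γ hγ
    have : Subgroup.zpowers ((qHat n q) ^ m) ≤
        MulAction.stabilizer (Equiv.Perm (rootSet n)) (ηpt n a ha) := by
      rw [Subgroup.zpowers_le, MulAction.mem_stabilizer_iff, Equiv.Perm.smul_def, hpow]
      apply Subtype.ext
      rw [aux_qHat_apply]
      simp [ηpt, hqm]
    exact this hγ
  have hfix2 : ∀ γ ∈ Subgroup.zpowers ((qHat n q) ^ m),
      γ (ηptNeg n a ha) = ηptNeg n a ha := by
    intro γ hγ
    have : Subgroup.zpowers ((qHat n q) ^ m) ≤
        MulAction.stabilizer (Equiv.Perm (rootSet n)) (ηptNeg n a ha) := by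
      rw [Subgroup.zpowers_le, MulAction.mem_stabilizer_iff, Equiv.Perm.smul_def, hpow]
      apply Subtype.ext
      rw [aux_qHat_apply]
      simp [ηptNeg, hqm]
    exact this hγ
  constructor
  · ext γ
    exact ⟨fun h => key γ h.1 h.2, fun h => ⟨hmem γ h, hfix1 γ h⟩⟩
  · ext γ
    constructor
    · rintro ⟨hγ, hset⟩
      have h1 : γ (ηpt n a ha) ∈ ({ηpt n a ha, ηptNeg n a ha} : Set (rootSet n)) := by
        rw [← hset]
        exact Set.mem_image_of_mem _ (Set.mem_insert _ _)
      rcases h1 with h1 | h1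
      · exact key γ hγ h1
      · exfalso
        obtain ⟨c, t, rfl⟩ := aux_form n q γ hγ
        have h := congrArg Subtype.val (Set.mem_singleton_iff.1 h1)
        simp only [Equiv.Perm.mul_apply, aux_trX_apply, aux_qHat_apply, ηpt, ηptNeg,
          Prod.mk.injEq, mul_zero, zero_add] at h
        obtain ⟨rfl, h2⟩ := h
        exact hasym t (eq_neg_of_add_eq_zero_left h2)
    · intro h
      refine ⟨hmem γ h, ?_⟩
      rw [Set.image_pair, hfix1 γ h, hfix2 γ h]
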